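/- Let A ∈ ℝ^{n×n}, B ∈ ℝ^{n×m}, K ∈ ℝ^{m×n}, φ the componentwise saturation function, f(e, v) = Ae + B(φ(Ke + v) − v), and for J ⊆ {1,…,m} let M_J = A + Σ_{i∈J} B₍ᵢ₎Kᵢ. Let P ∈ ℝ^{n×n} be symmetric positive definite and λ ∈ [0, 1). If λP − M_Jᵀ P M_J is positive semidefinite for every J ⊆ {1,…,m}, then for every e ∈ ℝⁿ and every v ∈ ℝᵐ with ‖v‖_∞ ≤ 1, f(e, v)ᵀ P f(e, v) ≤ λ · eᵀ P e. -/

import Mathlib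

open Matrix

/-- Componentwise saturation function: φᵢ(u) = sign(uᵢ)·min{|uᵢ|, 1}. -/
noncomputable def sat {m : ℕ} (u : Fin m → ℝ) : Fin m → ℝ :=
  fun i => Real.sign (u i) * min |u i| 1

/-- Saturated error map: f(e, v) = A e + B (φ(K e + v) − v). -/
noncomputable def fSat {n m : ℕ} (A : Matrix (Fin n) (Fin n) ℝ)
    (B : Matrix (Fin n) (Fin m) ℝ) (K : Matrix (Fin m) (Fin n) ℝ)
    (e : Fin n → ℝ) (v : Fin m → ℝ) : Fin n → ℝ :=
  A.mulVec e + B.mulVec (sat (K.mulVec e + v) - v)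

/-- M_J = A + Σ_{i∈J} B₍ᵢ₎ Kᵢ. -/
noncomputable def MJ {n m : ℕ} (A : Matrix (Fin n) (Fin n) ℝ)
    (B : Matrix (Fin n) (Fin m) ℝ) (K : Matrix (Fin m) (Fin n) ℝ)
    (J : Finset (Fin m)) : Matrix (Fin n) (Fin n) ℝ :=
  A + ∑ i ∈ J, Matrix.vecMulVec (fun r => B r i) (K i)

/-- If a convex set contains `a + ∑ i ∈ J, w i` for every `J ⊆ s`, it contains
`a + ∑ i ∈ s, θ i • w i` for all weights `θ i ∈ [0, 1]`. -/
theorem Convex.add_sum_smul_mem_of_forall_subset {ι E : Type*} [AddCommGroup E] [Module ℝ E]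
    {C : Set E} (hC : Convex ℝ C) (w : ι → E) (θ : ι → ℝ) (h0 : ∀ i, 0 ≤ θ i)
    (h1 : ∀ i, θ i ≤ 1) (s : Finset ι) (a : E) (h : ∀ J ⊆ s, a + ∑ i ∈ J, w i ∈ C) :
    a + ∑ i ∈ s, θ i • w i ∈ C := by
  classical
  induction s using Finset.induction_on generalizing a with
  | empty => simpa using h ∅
  | insert i s hi ih =>
    have hx := ih a fun J hJ => h J (hJ.trans (Finset.subset_insert i s))
    have hy := ih (a + w i) fun J hJ => by
      have := h (insert i J) (Finset.insert_subset_insert i hJ)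
      rwa [Finset.sum_insert fun hiJ => hi (hJ hiJ), ← add_assoc] at this
    have := hC hx hy (sub_nonneg.2 (h1 i)) (h0 i) (by ring)
    rw [Finset.sum_insert hi]
    convert this using 1
    module

/-- Sublevel sets of a positive semidefinite quadratic form are convex. -/
theorem Matrix.PosSemidef.convex_setOf_dotProduct_mulVec_le {n : Type*} [Fintype n]
    {P : Matrix n n ℝ} (hP : P.PosSemidef) (c : ℝ) :
    Convex ℝ {x : n → ℝ | x ⬝ᵥ P *ᵥ x ≤ c} := by
  intro x hx y hy s t hs ht hst
  simp only [Set.mem_ofPred_eq] at hx hy ⊢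
  have hxy : 0 ≤ (x - y) ⬝ᵥ P *ᵥ (x - y) := by
    simpa using hP.dotProduct_mulVec_nonneg (x - y)
  obtain rfl : t = 1 - s := by linarith
  simp only [mulVec_add, mulVec_sub, mulVec_smul, dotProduct_add, add_dotProduct, dotProduct_sub,
    sub_dotProduct, smul_dotProduct, dotProduct_smul, smul_eq_mul] at hxy ⊢
  nlinarith [mul_nonneg (mul_nonneg hs ht) hxy, mul_le_mul_of_nonneg_left hx hs,
    mul_le_mul_of_nonneg_left hy ht]

theorem Real.sign_mul_min_abs_one (u : ℝ) : Real.sign u * min |u| 1 = max (-1) (min u 1) := by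
  rcases lt_trichotomy u 0 with h | rfl | h
  · rw [Real.sign_of_neg h, abs_of_neg h, min_eq_left (by linarith : u ≤ 1), neg_one_mul,
      ← max_neg_neg, neg_neg, max_comm]
  · simp
  · rw [Real.sign_of_pos h, abs_of_pos h, one_mul, max_eq_right]
    exact le_min (by linarith) (by norm_num)

/-- Around a point `v ∈ [-1, 1]`, saturation scales increments by a factor in `[0, 1]`. -/
theorem exists_max_min_sub_eq_mul {v : ℝ} (hv : |v| ≤ 1) (k : ℝ) :
    ∃ θ : ℝ, 0 ≤ θ ∧ θ ≤ 1 ∧ max (-1) (min (k + v) 1) - v = θ * k := by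
  obtain ⟨hl, hu⟩ := abs_le.1 hv
  rcases lt_trichotomy k 0 with h | rfl | h
  · refine ⟨(max (-1) (min (k + v) 1) - v) / k, div_nonneg_of_nonpos ?_ h.le, ?_,
      (div_mul_cancel₀ _ h.ne).symm⟩
    · grind
    · rw [div_le_one_of_neg h]
      grind
  · exact ⟨0, le_rfl, zero_le_one, by simp [hl, hu]⟩
  · refine ⟨(max (-1) (min (k + v) 1) - v) / k, div_nonneg ?_ h.le, ?_,
      (div_mul_cancel₀ _ h.ne').symm⟩
    · grind
    · rw [div_le_one h]
      grind

theorem MJ_mulVec {n m : ℕ} (A : Matrix (Fin n) (Fin n) ℝ) (B : Matrix (Fin n) (Fin m) ℝ)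
    (K : Matrix (Fin m) (Fin n) ℝ) (J : Finset (Fin m)) (e : Fin n → ℝ) :
    MJ A B K J *ᵥ e = A *ᵥ e + ∑ i ∈ J, (K *ᵥ e) i • B.col i := by
  rw [MJ, add_mulVec, sum_mulVec]
  congr 1
  refine Finset.sum_congr rfl fun i _ => ?_
  rw [vecMulVec_mulVec]
  ext r
  simp [mulVec, mul_comm]

theorem fSat_contraction {n m : ℕ} (A : Matrix (Fin n) (Fin n) ℝ)
    (B : Matrix (Fin n) (Fin m) ℝ) (K : Matrix (Fin m) (Fin n) ℝ)
    (P : Matrix (Fin n) (Fin n) ℝ) (hP : P.PosDef)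
    (lam : ℝ) (hlam0 : 0 ≤ lam) (hlam1 : lam < 1)
    (hLMI : ∀ J : Finset (Fin m),
      (lam • P - (MJ A B K J)ᵀ * P * (MJ A B K J)).PosSemidef) :
    ∀ (e : Fin n → ℝ) (v : Fin m → ℝ), (∀ i, |v i| ≤ 1) →
      (fSat A B K e v) ⬝ᵥ P.mulVec (fSat A B K e v) ≤ lam * (e ⬝ᵥ P.mulVec e) := by
  intro e v hv
  choose θ h0 h1 hθ using fun i => exists_max_min_sub_eq_mul (hv i) ((K *ᵥ e) i)
  have hf : fSat A B K e v = A *ᵥ e + ∑ i, θ i • (K *ᵥ e) i • B.col i := by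
    ext r
    simp only [fSat, Pi.add_apply, Finset.sum_apply, Pi.smul_apply, smul_eq_mul, col_apply]
    congr 1
    change ∑ i, B r i * (sat (K *ᵥ e + v) - v) i = _
    refine Finset.sum_congr rfl fun i _ => ?_
    rw [Pi.sub_apply, sat, Real.sign_mul_min_abs_one, Pi.add_apply, hθ]
    ring
  rw [hf]
  refine (hP.posSemidef.convex_setOf_dotProduct_mulVec_le _).add_sum_smul_mem_of_forall_subset
    _ θ h0 h1 Finset.univ (A *ᵥ e) fun J _ => ?_
  have h := (hLMI J).dotProduct_mulVec_nonneg e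
  rw [star_trivial, sub_mulVec, dotProduct_sub, smul_mulVec, dotProduct_smul, smul_eq_mul,
    Matrix.mul_assoc, ← mulVec_mulVec, ← mulVec_mulVec, dotProduct_mulVec e (MJ A B K J)ᵀ, vecMul_transpose,
    MJ_mulVec] at h
  exact sub_nonneg.1 h
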